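/- arXiv:2402.13342 — 2 statements merged into one kernel-verified Lean document; each statement's English description precedes it below -/
import Mathlib

section
/- There exists a constant C ≥ 0 such that for every positive integer n there exist two tilings f and g of the upward triangle Δ of side n with the property that every sequence f = f₀, f₁, …, f_m = g, in which each f_{k+1} is obtained from f_k by a trapezoid flip, has length m ≥ 2n²/3 − n − C. In particular, the upper bound of 2n(n−1)/3 trapezoid flips needed to connect any two fine mixed subdivisions is tight up to terms of order O(n). -/
/-- The upward unit triangles of the side-`n` triangle Δ: pairs `(i,j)` with `i+j ≤ n-1`. -/
def UpTri (n : ℕ) : Set (ℕ × ℕ) := {p | p.1 + p.2 + 1 ≤ n}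

/-- The downward unit triangles of Δ: pairs `(i,j)` with `i+j ≤ n-2`. -/
def DownTri (n : ℕ) : Set (ℕ × ℕ) := {p | p.1 + p.2 + 2 ≤ n}

/-- The downward unit triangle `d` is adjacent to exactly the upward unit triangles
`d`, `(d.1+1, d.2)` and `(d.1, d.2+1)`. -/
def Adj (d u : ℕ × ℕ) : Prop :=
  u = d ∨ u = (d.1 + 1, d.2) ∨ u = (d.1, d.2 + 1)

/-- A fine mixed subdivision (tiling) of Δ with hole set `S`: a bijection `f` from the
downward unit triangles onto the upward unit triangles not in `S`, with `f d` adjacent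
to `d` for every `d`. -/
def IsTiling (n : ℕ) (S : Set (ℕ × ℕ)) (f : ℕ × ℕ → ℕ × ℕ) : Prop :=
  Set.BijOn f (DownTri n) (UpTri n \ S) ∧ ∀ d ∈ DownTri n, Adj d (f d)

/-- The upward unit triangles of the upward subtriangle `T(a,b,k)`. -/
def UpCells (a b k : ℕ) : Set (ℕ × ℕ) :=
  {p | a ≤ p.1 ∧ b ≤ p.2 ∧ p.1 + p.2 + 1 ≤ a + b + k}

/-- The downward unit triangles of the upward subtriangle `T(a,b,k)`. -/
def DownCells (a b k : ℕ) : Set (ℕ × ℕ) :=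
  {p | a ≤ p.1 ∧ b ≤ p.2 ∧ p.1 + p.2 + 2 ≤ a + b + k}

/-- `S` is spread-out: every upward subtriangle of size `k` contains at most `k` holes. -/
def SpreadOut (n : ℕ) (S : Finset (ℕ × ℕ)) : Prop :=
  ∀ a b k : ℕ, a + b + k ≤ n →
    (S.filter (fun p => a ≤ p.1 ∧ b ≤ p.2 ∧ p.1 + p.2 + 1 ≤ a + b + k)).card ≤ k

/-- `g` is obtained from the tiling `f` by a trapezoid flip: for some hole set `S` of `f`,
some hole `u ∈ S` and some downward unit triangle `d` adjacent to `u`, we have `g d = u`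
and `g d' = f d'` for all `d' ≠ d`. -/
def TrapFlip (n : ℕ) (f g : ℕ × ℕ → ℕ × ℕ) : Prop :=
  ∃ (S : Set (ℕ × ℕ)) (u d : ℕ × ℕ), IsTiling n S f ∧ u ∈ S ∧ d ∈ DownTri n ∧ Adj d u ∧
    g d = u ∧ ∀ d', d' ≠ d → g d' = f d'

/-- The downward triangles as a finset. -/
def downFin (n : ℕ) : Finset (ℕ × ℕ) :=
  (Finset.range (n - 1)).biUnion (fun s => Finset.HasAntidiagonal.antidiagonal s)

theorem mem_downFin (n : ℕ) (d : ℕ × ℕ) : d ∈ downFin n ↔ d.1 + d.2 + 2 ≤ n := by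
  simp only [downFin, Finset.mem_biUnion, Finset.mem_range, Finset.HasAntidiagonal.mem_antidiagonal]
  constructor
  · rintro ⟨s, hs, h⟩; omega
  · intro h; exact ⟨d.1 + d.2, by omega, rfl⟩

theorem card_downFin (n : ℕ) : 2 * (downFin n).card = n * (n - 1) := by
  unfold downFin
  rw [Finset.card_biUnion]
  · simp only [Finset.Nat.card_antidiagonal]
    rcases n with _ | n
    · simp
    · have h := Finset.sum_range_id_mul_two (n + 1)
      rw [Finset.sum_range_succ'] at h
      simp only [Nat.add_sub_cancel] at h ⊢
      omega
  · intro a _ b _ hab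
    rw [Function.onFun, Finset.disjoint_left]
    intro x hx hy
    simp only [Finset.HasAntidiagonal.mem_antidiagonal] at hx hy
    omega

/-- Rotation of every coloured hexagon in one direction. -/
def tilF (d : ℕ × ℕ) : ℕ × ℕ :=
  if (d.1 + 2 * d.2) % 3 = 0 then (d.1, d.2 + 1)
  else if (d.1 + 2 * d.2) % 3 = 1 then d else (d.1 + 1, d.2)

/-- Rotation of every coloured hexagon in the other direction. -/
def tilG (d : ℕ × ℕ) : ℕ × ℕ :=
  if (d.1 + 2 * d.2) % 3 = 0 then (d.1 + 1, d.2)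
  else if (d.1 + 2 * d.2) % 3 = 1 then (d.1, d.2 + 1) else d

/-- The coloured vertex of a downward triangle. -/
def vert (d : ℕ × ℕ) : ℕ × ℕ :=
  if (d.1 + 2 * d.2) % 3 = 0 then (d.1 + 1, d.2 + 1)
  else if (d.1 + 2 * d.2) % 3 = 1 then (d.1, d.2 + 1) else (d.1 + 1, d.2)

/-- Interior coloured vertices. -/
def InnerV (n : ℕ) (v : ℕ × ℕ) : Prop := 1 ≤ v.1 ∧ 1 ≤ v.2 ∧ v.1 + v.2 + 1 ≤ n

theorem tilF_inj : Function.Injective tilF := by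
  rintro ⟨a, b⟩ ⟨c, d⟩ h
  simp only [tilF] at h
  split_ifs at h <;> simp only [Prod.mk.injEq] at h ⊢ <;> omega

theorem tilG_inj : Function.Injective tilG := by
  rintro ⟨a, b⟩ ⟨c, d⟩ h
  simp only [tilG] at h
  split_ifs at h <;> simp only [Prod.mk.injEq] at h ⊢ <;> omega

theorem tilF_adj (d : ℕ × ℕ) : Adj d (tilF d) := by
  unfold Adj tilF; split_ifs <;> simp

theorem tilG_adj (d : ℕ × ℕ) : Adj d (tilG d) := by
  unfold Adj tilG; split_ifs <;> simp

theorem tilF_ne (d : ℕ × ℕ) : tilF d ≠ tilG d := by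
  obtain ⟨a, b⟩ := d
  intro h
  simp only [tilF, tilG] at h
  split_ifs at h <;> simp only [Prod.mk.injEq] at h <;> omega

theorem isTiling_of_inj (n : ℕ) (f : ℕ × ℕ → ℕ × ℕ) (hf : Function.Injective f)
    (ha : ∀ d, Adj d (f d)) : IsTiling n (UpTri n \ f '' DownTri n) f := by
  have hsub : f '' DownTri n ⊆ UpTri n := by
    rintro _ ⟨d, hd, rfl⟩
    simp only [DownTri, UpTri, Set.mem_ofPred_eq] at hd ⊢
    rcases ha d with h | h | h <;> rw [h] <;> (try dsimp only []) <;> omega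
  refine ⟨?_, fun d _ => ha d⟩
  rw [Set.sdiff_sdiff_cancel_left hsub]
  exact hf.injOn.bijOn_image

open Classical in
theorem card_bdry (n : ℕ) :
    ((downFin n).filter (fun d => ¬ InnerV n (vert d))).card ≤ n + 3 := by
  have hsub : (downFin n).filter (fun d => ¬ InnerV n (vert d)) ⊆
      ((Finset.range (n / 3 + 1)).image (fun t => (3 * t + 2, 0)) ∪
       (Finset.range (n / 3 + 1)).image (fun t => (0, 3 * t + 2))) ∪
       (Finset.range (n / 3 + 1)).image
        (fun t => (3 * t + (2 * n + 2) % 3, n - 2 - (3 * t + (2 * n + 2) % 3))) := by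
    rintro ⟨i, j⟩ h
    rw [Finset.mem_filter, mem_downFin] at h
    simp only [InnerV, vert] at h
    simp only [Finset.mem_union, Finset.mem_image, Finset.mem_range, Prod.mk.injEq]
    obtain ⟨h1, h2⟩ := h
    split_ifs at h2 with h3 h4
    · right
      have e1 : n = i + j + 2 := by omega
      have e2 : (2 * n + 2) % 3 = i % 3 := by
        have : 2 * n + 2 = (i + 2 * j) + i + 6 := by omega
        omega
      rw [e2]
      exact ⟨i / 3, by omega, by omega, by omega⟩
    · left; right; exact ⟨j / 3, by omega, by omega, by omega⟩
    · left; left; exact ⟨i / 3, by omega, by omega, by omega⟩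
  refine (Finset.card_le_card hsub).trans ?_
  refine (Finset.card_union_le _ _).trans ?_
  refine (Nat.add_le_add_right (Finset.card_union_le _ _) _).trans ?_
  have h1 := Finset.card_image_le (s := Finset.range (n / 3 + 1))
    (f := fun t => ((3 * t + 2, 0) : ℕ × ℕ))
  have h2 := Finset.card_image_le (s := Finset.range (n / 3 + 1))
    (f := fun t => ((0, 3 * t + 2) : ℕ × ℕ))
  have h3 := Finset.card_image_le (s := Finset.range (n / 3 + 1))
    (f := fun t => ((3 * t + (2 * n + 2) % 3, n - 2 - (3 * t + (2 * n + 2) % 3)) : ℕ × ℕ))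
  rw [Finset.card_range] at h1 h2 h3
  omega

theorem persist (m : ℕ) (F : ℕ → ℕ × ℕ → ℕ × ℕ) (D : ℕ → ℕ × ℕ)
    (hD : ∀ k < m, ∀ d, d ≠ D k → F (k + 1) d = F k d) (d : ℕ × ℕ) (a b : ℕ) (hab : a ≤ b)
    (hb : b ≤ m) (h : ∀ k, a ≤ k → k < b → D k ≠ d) : F b d = F a d := by
  induction b, hab using Nat.le_induction with
  | base => rfl
  | succ b hab ih =>
    rw [hD b (by omega) d (h b hab (by omega)).symm]
    exact ih (by omega) (fun k hk hk' => h k hk (by omega))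

/-- If `d` moves exactly once and so does `e`, and the target of `e` is the source of `d`,
then `d` moves before `e`. -/
theorem move_before (n m : ℕ) (F : ℕ → ℕ × ℕ → ℕ × ℕ) (D : ℕ → ℕ × ℕ)
    (hD : ∀ k < m, ∀ d, d ≠ D k → F (k + 1) d = F k d)
    (hinj : ∀ k ≤ m, Set.InjOn (F k) (DownTri n))
    (d e : ℕ × ℕ) (hd : d ∈ DownTri n) (he : e ∈ DownTri n) (hne : d ≠ e)
    (s t : ℕ) (hs : s < m) (ht : t < m) (hDs : D s = d) (hDt : D t = e)
    (hs' : ∀ k < m, D k = d → k = s) (ht' : ∀ k < m, D k = e → k = t)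
    (hde : F 0 d = F m e) : s < t := by
  by_contra hcon
  have hst : s ≠ t := by rintro rfl; exact hne (hDs.symm.trans hDt)
  have h1 : F (t + 1) d = F 0 d := by
    apply persist m F D hD d 0 (t + 1) (by omega) (by omega)
    intro k _ hk hkd
    have := hs' k (by omega) hkd
    omega
  have h2 : F m e = F (t + 1) e := by
    apply persist m F D hD e (t + 1) m (by omega) le_rfl
    intro k hk hk' hke
    have := ht' k (by omega) hke
    omega
  exact hne (hinj (t + 1) (by omega) hd he (by rw [h1, hde, h2]))

theorem count_bound (n m : ℕ) (F : ℕ → ℕ × ℕ → ℕ × ℕ) (D : ℕ → ℕ × ℕ)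
    (hD : ∀ k < m, ∀ d, d ≠ D k → F (k + 1) d = F k d)
    (hDm : ∀ k < m, D k ∈ DownTri n)
    (hinj : ∀ k ≤ m, Set.InjOn (F k) (DownTri n))
    (h0 : F 0 = tilF) (hm : Set.EqOn (F m) tilG (DownTri n)) :
    4 * (downFin n).card ≤ 3 * m + (n + 3) := by
  classical
  set N : ℕ × ℕ → ℕ := fun d => ((Finset.range m).filter (fun k => D k = d)).card with hN
  have hsum : ∑ d ∈ downFin n, N d = m := by
    have := Finset.card_eq_sum_card_fiberwise (s := Finset.range m) (t := downFin n) (f := D)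
      (by
        intro k hk
        have := hDm k (by simpa using hk)
        exact (mem_downFin n _).2 this)
    rw [Finset.card_range] at this
    exact this.symm
  have hpos : ∀ d ∈ DownTri n, 1 ≤ N d := by
    intro d hd
    by_contra hcon
    have h00 : N d = 0 := by omega
    rw [hN] at h00
    simp only [Finset.card_eq_zero, Finset.filter_eq_empty_iff, Finset.mem_range] at h00
    have := persist m F D hD d 0 m (by omega) le_rfl (fun k _ hk => h00 hk)
    rw [hm hd, h0] at this
    exact tilF_ne d this.symm
  have hone : ∀ d, N d = 1 → ∃ t < m, D t = d ∧ ∀ k < m, D k = d → k = t := by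
    intro d hd
    rw [hN] at hd
    obtain ⟨t, ht⟩ := Finset.card_eq_one.1 hd
    have hmem : ∀ k, (k < m ∧ D k = d) ↔ k = t := by
      intro k
      have : k ∈ (Finset.range m).filter (fun k => D k = d) ↔ k ∈ ({t} : Finset ℕ) := by rw [ht]
      simpa using this
    obtain ⟨h1, h2⟩ := (hmem t).2 rfl
    exact ⟨t, h1, h2, fun k hk hk' => (hmem k).1 ⟨hk, hk'⟩⟩
  have hcyc : ∀ x y z, x ∈ DownTri n → y ∈ DownTri n → z ∈ DownTri n → x ≠ y → y ≠ z → z ≠ x →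
      tilF x = tilG y → tilF y = tilG z → tilF z = tilG x → 4 ≤ N x + N y + N z := by
    intro x y z hx hy hz hxy hyz hzx e1 e2 e3
    have px := hpos x hx
    have py := hpos y hy
    have pz := hpos z hz
    by_contra hcon
    obtain ⟨r, hr, hr1, hr2⟩ := hone x (by omega)
    obtain ⟨s, hs, hs1, hs2⟩ := hone y (by omega)
    obtain ⟨t, ht, ht1, ht2⟩ := hone z (by omega)
    have a1 := move_before n m F D hD hinj x y hx hy hxy r s hr hs hr1 hs1 hr2 hs2
      (by rw [h0, hm hy, e1])
    have a2 := move_before n m F D hD hinj y z hy hz hyz s t hs ht hs1 ht1 hs2 ht2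
      (by rw [h0, hm hz, e2])
    have a3 := move_before n m F D hD hinj z x hz hx hzx t r ht hr ht1 hr1 ht2 hr2
      (by rw [h0, hm hx, e3])
    omega
  have key : ∑ d ∈ downFin n, (if InnerV n (vert d) then 4 else 3) ≤ ∑ d ∈ downFin n, 3 * N d := by
    have hmaps : ∀ d ∈ downFin n, vert d ∈ (downFin n).image vert :=
      fun d hd => Finset.mem_image_of_mem _ hd
    rw [← Finset.sum_fiberwise_of_maps_to hmaps, ← Finset.sum_fiberwise_of_maps_to hmaps]
    apply Finset.sum_le_sum
    intro v hv
    by_cases hin : InnerV n v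
    · obtain ⟨d₀, hd₀, hv₀⟩ := Finset.mem_image.1 hv
      obtain ⟨a, b⟩ := v
      have hcol : (a + 2 * b) % 3 = 0 := by
        simp only [vert] at hv₀
        split_ifs at hv₀ <;> simp only [Prod.mk.injEq] at hv₀ <;> omega
      simp only [InnerV] at hin
      obtain ⟨a, rfl⟩ : ∃ a', a = a' + 1 := ⟨a - 1, by omega⟩
      obtain ⟨b, rfl⟩ : ∃ b', b = b' + 1 := ⟨b - 1, by omega⟩
      have hfib : (downFin n).filter (fun d => vert d = (a + 1, b + 1)) =
          {(a, b + 1), (a, b), (a + 1, b)} := by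
        ext ⟨i, j⟩
        rw [Finset.mem_filter, mem_downFin]
        simp only [vert, Finset.mem_insert,
          Finset.mem_singleton, Prod.mk.injEq]
        constructor
        · rintro ⟨h1, h2⟩
          split_ifs at h2 <;> simp only [Prod.mk.injEq] at h2 <;> omega
        · rintro (⟨rfl, rfl⟩ | ⟨rfl, rfl⟩ | ⟨rfl, rfl⟩) <;>
            (refine ⟨by omega, ?_⟩; split_ifs <;> simp only [Prod.mk.injEq] <;> omega)
      have hle : ∑ d ∈ (downFin n).filter (fun d => vert d = (a + 1, b + 1)),
          (if InnerV n (vert d) then 4 else 3) ≤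
          ∑ d ∈ (downFin n).filter (fun d => vert d = (a + 1, b + 1)), 4 := by
        apply Finset.sum_le_sum
        intro d _
        split_ifs <;> omega
      refine hle.trans ?_
      rw [hfib]
      have n1 : ((a, b + 1) : ℕ × ℕ) ∉ ({(a, b), (a + 1, b)} : Finset (ℕ × ℕ)) := by simp
      have n2 : ((a, b) : ℕ × ℕ) ∉ ({(a + 1, b)} : Finset (ℕ × ℕ)) := by simp
      rw [Finset.sum_insert n1, Finset.sum_insert n2, Finset.sum_singleton,
        Finset.sum_insert n1, Finset.sum_insert n2, Finset.sum_singleton]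
      have r1 : (a + 2 * (b + 1)) % 3 = 2 := by omega
      have r2 : (a + 2 * b) % 3 = 0 := by omega
      have r3 : (a + 1 + 2 * b) % 3 = 1 := by omega
      have := hcyc (a, b + 1) (a + 1, b) (a, b)
        (by simp only [DownTri, Set.mem_ofPred_eq]; omega)
        (by simp only [DownTri, Set.mem_ofPred_eq]; omega)
        (by simp only [DownTri, Set.mem_ofPred_eq]; omega)
        (by simp) (by simp) (by simp)
        (by simp [tilF, tilG, r1, r3]) (by simp [tilF, tilG, r2, r3]) (by simp [tilF, tilG, r1, r2])
      omega
    · apply Finset.sum_le_sum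
      intro d hd
      rw [Finset.mem_filter, mem_downFin] at hd
      rw [if_neg (by rw [hd.2]; exact hin)]
      have := hpos d hd.1
      omega
  rw [← Finset.mul_sum, hsum] at key
  have hb := card_bdry n
  have h4 : ∑ d ∈ downFin n, (if InnerV n (vert d) then 4 else 3) +
      ((downFin n).filter (fun d => ¬ InnerV n (vert d))).card = 4 * (downFin n).card := by
    rw [Finset.card_filter, ← Finset.sum_add_distrib]
    rw [Finset.sum_congr rfl (g := fun _ => 4) (by intro d _; split_ifs <;> simp_all)]
    simp [mul_comm]
  have hb' : ((downFin n).filter (fun d => ¬ InnerV n (vert d))).card ≤ n + 3 := by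
    convert hb
  omega

/-- There is a constant `C ≥ 0` such that for every `n` there are two
tilings of Δ which cannot be connected by fewer than `2n²/3 - n - C` trapezoid flips
(stated as `2n² ≤ 3m + 3n + 3C`): the upper bound `2n(n-1)/3` is tight up to `O(n)`. -/
theorem trapezoid_flip_lower_bound_tight :
    ∃ C : ℕ, ∀ n : ℕ, 0 < n →
      ∃ (Sf Sg : Set (ℕ × ℕ)) (f g : ℕ × ℕ → ℕ × ℕ),
        IsTiling n Sf f ∧ IsTiling n Sg g ∧
        ∀ (m : ℕ) (F : ℕ → ℕ × ℕ → ℕ × ℕ),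
          F 0 = f → Set.EqOn (F m) g (DownTri n) →
          (∀ k < m, TrapFlip n (F k) (F (k + 1))) →
          2 * n ^ 2 ≤ 3 * m + 3 * n + 3 * C := by
  refine ⟨1, fun n hn => ⟨_, _, tilF, tilG, isTiling_of_inj n tilF tilF_inj tilF_adj,
    isTiling_of_inj n tilG tilG_inj tilG_adj, ?_⟩⟩
  intro m F h0 hm hstep
  have hex : ∀ k, ∃ d, k < m → d ∈ DownTri n ∧ ∀ d', d' ≠ d → F (k + 1) d' = F k d' := by
    intro k
    by_cases hk : k < m
    · obtain ⟨S, u, d, _, _, hd, _, _, h⟩ := hstep k hk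
      exact ⟨d, fun _ => ⟨hd, h⟩⟩
    · exact ⟨(0, 0), fun h => absurd h hk⟩
  choose D hD using hex
  have hinj : ∀ k ≤ m, Set.InjOn (F k) (DownTri n) := by
    intro k hk
    rcases Nat.lt_or_ge k m with h | h
    · obtain ⟨S, u, d, hT, _⟩ := hstep k h
      exact hT.1.injOn
    · obtain rfl : k = m := le_antisymm hk h
      exact (tilG_inj.injOn).congr hm.symm
  have h1 := count_bound n m F D (fun k hk => (hD k hk).2) (fun k hk => (hD k hk).1) hinj h0 hm
  have h2 := card_downFin n
  obtain ⟨p, rfl⟩ : ∃ p, n = p + 1 := ⟨n - 1, by omega⟩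
  simp only [Nat.add_sub_cancel] at h2
  nlinarith
end

section
/- A tiling f of Δ contains a CW-GD at some (a,b,m) if and only if the rhombus graph of f contains a clockwise directed cycle. -/
/-- The upward unit triangles of the GD ring `R(a,b,m)`: upward cells of `T(a,b,m)` other
than the three corners and the cells of the central subtriangle `T(a+1,b+1,m-3)`. -/
def RingUp (a b m : ℕ) : Set (ℕ × ℕ) :=
  UpCells a b m \ ({(a, b), (a + m - 1, b), (a, b + m - 1)} ∪ UpCells (a + 1) (b + 1) (m - 3))

/-- The downward unit triangles of the GD ring `R(a,b,m)`. -/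
def RingDown (a b m : ℕ) : Set (ℕ × ℕ) :=
  DownCells a b m \ DownCells (a + 1) (b + 1) (m - 3)

/-- `f` contains a clockwise GD at `(a,b,m)`. -/
def CWGD (f : ℕ × ℕ → ℕ × ℕ) (a b m : ℕ) : Prop :=
  f '' RingDown a b m = RingUp a b m ∧ f (a, b) = (a, b + 1)

/-- `f` contains a counterclockwise GD at `(a,b,m)`. -/
def CCWGD (f : ℕ × ℕ → ℕ × ℕ) (a b m : ℕ) : Prop :=
  f '' RingDown a b m = RingUp a b m ∧ f (a, b) = (a + 1, b)

/-- `g` is obtained from `f` by a GD flip at `(a,b,m)`. -/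
def GDFlipAt (n : ℕ) (f g : ℕ × ℕ → ℕ × ℕ) (a b m : ℕ) : Prop :=
  3 ≤ m ∧ a + b + m ≤ n ∧ CWGD f a b m ∧ CCWGD g a b m ∧
    (∃ S : Set (ℕ × ℕ), IsTiling n S f ∧ IsTiling n S g) ∧
    ∀ d ∈ DownTri n, d ∉ RingDown a b m → g d = f d

/-- `g` is obtained from `f` by a GD flip (at some position). -/
def GDFlip (n : ℕ) (f g : ℕ × ℕ → ℕ × ℕ) : Prop :=
  ∃ a b m, GDFlipAt n f g a b m

/-- The rhombus graph of a tiling `f`: an edge `d → d'` whenever `d ≠ d'` are downward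
unit triangles and the upward triangle `f d` is adjacent to `d'`. -/
def RhEdge (n : ℕ) (f : ℕ × ℕ → ℕ × ℕ) (d d' : ℕ × ℕ) : Prop :=
  d ∈ DownTri n ∧ d' ∈ DownTri n ∧ d ≠ d' ∧ Adj d' (f d)

/-- The planar embedding of a grid node: `P(i,j) = (i + j/2, j·√3/2)`. -/
noncomputable def gridPt (p : ℕ × ℕ) : ℝ × ℝ :=
  ((p.1 : ℝ) + (p.2 : ℝ) / 2, (p.2 : ℝ) * Real.sqrt 3 / 2)

/-- The centroid of the upward unit triangle `(i,j)`. -/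
noncomputable def upCentroid (p : ℕ × ℕ) : ℝ × ℝ :=
  (((gridPt p).1 + (gridPt (p.1 + 1, p.2)).1 + (gridPt (p.1, p.2 + 1)).1) / 3,
   ((gridPt p).2 + (gridPt (p.1 + 1, p.2)).2 + (gridPt (p.1, p.2 + 1)).2) / 3)

/-- The centroid of the downward unit triangle `(i,j)`. -/
noncomputable def downCentroid (p : ℕ × ℕ) : ℝ × ℝ :=
  (((gridPt (p.1 + 1, p.2)).1 + (gridPt (p.1, p.2 + 1)).1 + (gridPt (p.1 + 1, p.2 + 1)).1) / 3,
   ((gridPt (p.1 + 1, p.2)).2 + (gridPt (p.1, p.2 + 1)).2 + (gridPt (p.1 + 1, p.2 + 1)).2) / 3)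

/-- The cross product entering the shoelace formula. -/
def cross2 (u v : ℝ × ℝ) : ℝ := u.1 * v.2 - v.1 * u.2

/-- The `2k` points of the closed polygonal path through the centroids of
`d₀, f d₀, d₁, f d₁, …, d_{k-1}, f d_{k-1}`. -/
noncomputable def cyclePt (f : ℕ × ℕ → ℕ × ℕ) (d : ℕ → ℕ × ℕ) (i : ℕ) : ℝ × ℝ :=
  if i % 2 = 0 then downCentroid (d (i / 2)) else upCentroid (f (d (i / 2)))

/-- The rhombus graph of `f` contains a clockwise directed cycle: a directed cycle
`d₀ → d₁ → ⋯ → d_{k-1} → d₀` (with distinct vertices) such that the closed polygonal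
path through the centroids of `d₀, f d₀, d₁, f d₁, …, d_{k-1}, f d_{k-1}` has negative
signed (shoelace) area. -/
noncomputable def HasClockwiseCycle (n : ℕ) (f : ℕ × ℕ → ℕ × ℕ) : Prop :=
  ∃ (k : ℕ) (d : ℕ → ℕ × ℕ), 0 < k ∧
    (∀ i < k, ∀ j < k, d i = d j → i = j) ∧
    (∀ i < k, RhEdge n f (d i) (d ((i + 1) % k))) ∧
    (∑ i ∈ Finset.range (2 * k),
        cross2 (cyclePt f d i) (cyclePt f d ((i + 1) % (2 * k)))) / 2 < 0

namespace CW

/-- Contribution of one step to the winding number around `(p,q)`. -/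
def wst (p q : ℕ) (d u d' : ℕ × ℕ) : ℤ :=
  (if u = (d.1, d.2 + 1) ∧ d.2 + 1 = q ∧ p ≤ d.1 then 1 else 0) -
  (if u = (d'.1, d'.2 + 1) ∧ d'.2 + 1 = q ∧ p ≤ d'.1 then 1 else 0)

/-- Contribution of one step to the flow out of `c` into `v`. -/
def flo (c v : ℕ × ℕ) (d u d' : ℕ × ℕ) : ℤ :=
  (if d = c ∧ u = v then 1 else 0) - (if d' = c ∧ u = v then 1 else 0)

/-- Contribution of one step to the area. -/
def hst (d u d' : ℕ × ℕ) : ℤ :=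
  (if u = (d.1, d.2 + 1) then (d.1 : ℤ) + 1 else 0) -
  (if u = (d'.1, d'.2 + 1) then (d'.1 : ℤ) + 1 else 0)

lemma wst_YZ (i j : ℕ) (d u d' : ℕ × ℕ) (h1 : Adj d u) (h2 : Adj d' u) :
    wst i (j+1) d u d' - wst (i+1) (j+1) d u d' = flo (i,j) (i,j+1) d u d' := by
  obtain ⟨x, y⟩ := d; obtain ⟨s, t⟩ := u; obtain ⟨x', y'⟩ := d'
  simp only [Adj, wst, flo, Prod.mk.injEq] at *
  split_ifs <;> omega

lemma wst_ZX (i j : ℕ) (d u d' : ℕ × ℕ) (h1 : Adj d u) (h2 : Adj d' u) :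
    wst (i+1) (j+1) d u d' - wst (i+1) j d u d' = flo (i,j) (i+1,j) d u d' +
      ((if d.2 = j ∧ i + 1 ≤ d.1 then 1 else 0) - (if d'.2 = j ∧ i + 1 ≤ d'.1 then 1 else 0)) := by
  obtain ⟨x, y⟩ := d; obtain ⟨s, t⟩ := u; obtain ⟨x', y'⟩ := d'
  simp only [Adj, wst, flo, Prod.mk.injEq] at *
  rcases h1 with ⟨rfl, rfl⟩ | ⟨rfl, rfl⟩ | ⟨rfl, rfl⟩ <;> grind (splits := 30)

lemma wst_XY (i j : ℕ) (d u d' : ℕ × ℕ) (h1 : Adj d u) (h2 : Adj d' u) :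
    wst (i+1) j d u d' - wst i (j+1) d u d' = flo (i,j) (i,j) d u d' +
      ((if d'.2 = j ∧ i ≤ d'.1 then 1 else 0) - (if d.2 = j ∧ i ≤ d.1 then 1 else 0)) := by
  obtain ⟨x, y⟩ := d; obtain ⟨s, t⟩ := u; obtain ⟨x', y'⟩ := d'
  simp only [Adj, wst, flo, Prod.mk.injEq] at *
  rcases h1 with ⟨rfl, rfl⟩ | ⟨rfl, rfl⟩ | ⟨rfl, rfl⟩ <;> grind (splits := 30)

lemma wst_zero (q : ℕ) (d u d' : ℕ × ℕ) (h1 : Adj d u) (h2 : Adj d' u) :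
    wst 0 q d u d' = (if q ≤ d'.2 then 1 else 0) - (if q ≤ d.2 then 1 else 0) := by
  obtain ⟨x, y⟩ := d; obtain ⟨s, t⟩ := u; obtain ⟨x', y'⟩ := d'
  simp only [Adj, wst, Prod.mk.injEq] at *
  split_ifs <;> omega

lemma wst_row (p : ℕ) (d u d' : ℕ × ℕ) : wst p 0 d u d' = 0 := by
  simp [wst]

lemma wst_diag (n p q : ℕ) (h : n ≤ p + q) (d u d' : ℕ × ℕ) (h1 : d ∈ DownTri n)
    (h2 : d' ∈ DownTri n) : wst p q d u d' = 0 := by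
  simp only [DownTri, Set.mem_ofPred_eq, wst] at *
  split_ifs <;> omega

lemma sum_wst (n : ℕ) (d u d' : ℕ × ℕ) (h1 : d ∈ DownTri n)
    (h2 : d' ∈ DownTri n) :
    ∑ p ∈ Finset.range n, ∑ q ∈ Finset.range n, wst p q d u d' = hst d u d' := by
  have key : ∀ (c : ℕ × ℕ), c ∈ DownTri n → ∑ p ∈ Finset.range n, ∑ q ∈ Finset.range n,
      (if u = (c.1, c.2 + 1) ∧ c.2 + 1 = q ∧ p ≤ c.1 then (1:ℤ) else 0) =
      if u = (c.1, c.2 + 1) then (c.1 : ℤ) + 1 else 0 := by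
    intro c hc
    simp only [DownTri, Set.mem_ofPred_eq] at hc
    by_cases hu : u = (c.1, c.2 + 1)
    · simp only [hu, true_and, if_true]
      have : ∀ p ∈ Finset.range n, (∑ q ∈ Finset.range n,
          if c.2 + 1 = q ∧ p ≤ c.1 then (1:ℤ) else 0) = if p ≤ c.1 then 1 else 0 := by
        intro p _
        rw [Finset.sum_eq_single (c.2 + 1)]
        · simp
        · intro b _ hb
          rw [if_neg]; rintro ⟨h, _⟩; exact hb h.symm
        · intro h; simp only [Finset.mem_range] at h; omega
      rw [Finset.sum_congr rfl this, Finset.sum_ite, Finset.sum_const_zero, add_zero,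
        Finset.sum_const]
      have h3 : (Finset.range n).filter (fun p => p ≤ c.1) = Finset.range (c.1 + 1) := by
        ext p; simp only [Finset.mem_filter, Finset.mem_range]; omega
      rw [h3]; simp
    · simp [hu]
  simp only [wst, hst, Finset.sum_sub_distrib]
  rw [key d h1, key d' h2]

lemma area_step (d u d' : ℕ × ℕ) (h1 : Adj d u) (h2 : Adj d' u) :
    cross2 (downCentroid d) (upCentroid u) + cross2 (upCentroid u) (downCentroid d') =
    Real.sqrt 3 * (hst d u d' : ℤ) + Real.sqrt 3 / 18 *
      ((((3 * (d'.1:ℝ) + 3 - 9 * d'.2)) - (3 * (d.1:ℝ) + 3 - 9 * d.2))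
       - ((3 * (d'.1:ℝ) + 2) * (3 * (d'.2:ℝ) + 2) - (3 * (d.1:ℝ) + 2) * (3 * (d.2:ℝ) + 2))) := by
  obtain ⟨x, y⟩ := d; obtain ⟨s, t⟩ := u; obtain ⟨x', y'⟩ := d'
  simp only [Adj, hst, Prod.mk.injEq, cross2, downCentroid, upCentroid, gridPt] at *
  rcases h1 with ⟨h1, h1'⟩ | ⟨h1, h1'⟩ | ⟨h1, h1'⟩ <;>
  rcases h2 with ⟨h2, h2'⟩ | ⟨h2, h2'⟩ | ⟨h2, h2'⟩ <;>
  (split_ifs <;> first | omega | skip) <;>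
  (have r1 : (s : ℝ) = _ := congrArg Nat.cast h1
   have r2 : (t : ℝ) = _ := congrArg Nat.cast h1'
   have r3 : (s : ℝ) = _ := congrArg Nat.cast h2
   have r4 : (t : ℝ) = _ := congrArg Nat.cast h2'
   push_cast at r1 r2 r3 r4 ⊢
   first
     | (have r5 : (x' : ℝ) = s := by linarith
        have r6 : (y' : ℝ) = t := by linarith
        rw [r5, r6, r1, r2]; ring)
     | (have r5 : (x' : ℝ) = s - 1 := by linarith
        have r6 : (y' : ℝ) = t := by linarith
        rw [r5, r6, r1, r2]; ring)
     | (have r5 : (x' : ℝ) = s := by linarith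
        have r6 : (y' : ℝ) = t - 1 := by linarith
        rw [r5, r6, r1, r2]; ring))

lemma tele {M : Type*} [AddCommGroup M] (k : ℕ) (hk : 0 < k) (φ : ℕ → M) :
    ∑ i ∈ Finset.range k, (φ ((i+1) % k) - φ i) = 0 := by
  obtain ⟨m, rfl⟩ : ∃ m, k = m + 1 := ⟨k - 1, by omega⟩
  rw [Finset.sum_sub_distrib, Finset.sum_range_succ, Nat.mod_self, Finset.sum_range_succ' φ]
  have : ∑ x ∈ Finset.range m, φ ((x + 1) % (m + 1)) = ∑ x ∈ Finset.range m, φ (x + 1) := by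
    apply Finset.sum_congr rfl
    intro x hx
    rw [Finset.mem_range] at hx
    rw [Nat.mod_eq_of_lt (by omega)]
  rw [this]; simp

lemma sum_two {M : Type*} [AddCommMonoid M] (k : ℕ) (g : ℕ → M) :
    ∑ i ∈ Finset.range (2 * k), g i = ∑ i ∈ Finset.range k, (g (2 * i) + g (2 * i + 1)) := by
  induction k with
  | zero => simp
  | succ k ih =>
    rw [Finset.sum_range_succ, ← ih, show 2 * (k + 1) = 2 * k + 1 + 1 by ring,
      Finset.sum_range_succ, Finset.sum_range_succ, add_assoc]

lemma area_eq (f : ℕ × ℕ → ℕ × ℕ) (k : ℕ) (hk : 0 < k) (d : ℕ → ℕ × ℕ)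
    (h1 : ∀ i < k, Adj (d i) (f (d i))) (h2 : ∀ i < k, Adj (d ((i+1) % k)) (f (d i))) :
    ∑ i ∈ Finset.range (2 * k), cross2 (cyclePt f d i) (cyclePt f d ((i + 1) % (2 * k))) =
    Real.sqrt 3 * ((∑ i ∈ Finset.range k, hst (d i) (f (d i)) (d ((i+1) % k)) : ℤ) : ℝ) := by
  rw [sum_two]
  set G : ℕ → ℝ := fun i => Real.sqrt 3 / 18 *
    ((3 * ((d i).1:ℝ) + 3 - 9 * (d i).2) - (3 * ((d i).1:ℝ) + 2) * (3 * ((d i).2:ℝ) + 2)) with hG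
  have : ∀ i ∈ Finset.range k,
      cross2 (cyclePt f d (2 * i)) (cyclePt f d ((2 * i + 1) % (2 * k))) +
      cross2 (cyclePt f d (2 * i + 1)) (cyclePt f d ((2 * i + 1 + 1) % (2 * k))) =
      Real.sqrt 3 * ((hst (d i) (f (d i)) (d ((i+1) % k)) : ℤ) : ℝ) + (G ((i + 1) % k) - G i) := by
    intro i hi
    rw [Finset.mem_range] at hi
    have e1 : (2 * i + 1) % (2 * k) = 2 * i + 1 := Nat.mod_eq_of_lt (by omega)
    have e2 : (2 * i + 1 + 1) % (2 * k) = 2 * ((i + 1) % k) := by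
      rw [← Nat.mul_mod_mul_left]; congr 1
    have c1 : ∀ j, cyclePt f d (2 * j) = downCentroid (d j) := by
      intro j; simp [cyclePt]
    have c2 : cyclePt f d (2 * i + 1) = upCentroid (f (d i)) := by
      have : (2 * i + 1) / 2 = i := by omega
      simp [cyclePt, this]
    rw [e1, e2, c1, c1, c2, area_step _ _ _ (h1 i hi) (h2 i hi)]
    simp only [hG]; ring
  rw [Finset.sum_congr rfl this, Finset.sum_add_distrib, tele k hk G, add_zero,
    ← Finset.mul_sum]
  push_cast; rfl

end CW
namespace CW

/-- Winding number of the cycle around `(p,q)`. -/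
def wind (f : ℕ × ℕ → ℕ × ℕ) (k : ℕ) (d : ℕ → ℕ × ℕ) (p q : ℕ) : ℤ :=
  ∑ i ∈ Finset.range k, wst p q (d i) (f (d i)) (d ((i+1) % k))

/-- Flow of the cycle out of `c` into `v`. -/
def flow (f : ℕ × ℕ → ℕ × ℕ) (k : ℕ) (d : ℕ → ℕ × ℕ) (c v : ℕ × ℕ) : ℤ :=
  ∑ i ∈ Finset.range k, flo c v (d i) (f (d i)) (d ((i+1) % k))

section
variable {n : ℕ} {S : Set (ℕ × ℕ)} {f : ℕ × ℕ → ℕ × ℕ} {k : ℕ} {d : ℕ → ℕ × ℕ}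

lemma flow_nonneg (hf : IsTiling n S f) (he : ∀ i < k, RhEdge n f (d i) (d ((i + 1) % k)))
    (c v : ℕ × ℕ) (hc : c ∈ DownTri n) (hv : f c = v) : 0 ≤ flow f k d c v := by
  apply Finset.sum_nonneg
  intro i hi
  rw [Finset.mem_range] at hi
  obtain ⟨a1, a2, a3, a4⟩ := he i hi
  have : ¬ (d ((i+1) % k) = c ∧ f (d i) = v) := by
    rintro ⟨e1, e2⟩
    apply a3
    rw [e1]
    exact hf.1.injOn a1 hc (e2.trans hv.symm)
  rw [flo, if_neg this]
  split_ifs <;> simp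

lemma flow_nonpos (c v : ℕ × ℕ) (hv : f c ≠ v) : flow f k d c v ≤ 0 := by
  apply Finset.sum_nonpos
  intro i hi
  have : ¬ (d i = c ∧ f (d i) = v) := by
    rintro ⟨e1, e2⟩
    rw [e1] at e2; exact hv e2
  rw [flo, if_neg this]
  split_ifs <;> simp

lemma wind_YZ (h1 : ∀ i < k, Adj (d i) (f (d i))) (h2 : ∀ i < k, Adj (d ((i+1) % k)) (f (d i)))
    (i j : ℕ) : wind f k d i (j+1) - wind f k d (i+1) (j+1) = flow f k d (i,j) (i,j+1) := by
  rw [wind, wind, flow, ← Finset.sum_sub_distrib]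
  apply Finset.sum_congr rfl
  intro t ht
  rw [Finset.mem_range] at ht
  exact wst_YZ _ _ _ _ _ (h1 t ht) (h2 t ht)

lemma wind_ZX (hk : 0 < k) (h1 : ∀ i < k, Adj (d i) (f (d i)))
    (h2 : ∀ i < k, Adj (d ((i+1) % k)) (f (d i)))
    (i j : ℕ) : wind f k d (i+1) (j+1) - wind f k d (i+1) j = flow f k d (i,j) (i+1,j) := by
  have := tele k hk (fun t => - (if (d t).2 = j ∧ i + 1 ≤ (d t).1 then (1:ℤ) else 0))
  rw [wind, wind, flow, ← Finset.sum_sub_distrib, ← add_zero (Finset.sum _ (fun i_1 => flo _ _ _ _ _)),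
    ← this, ← Finset.sum_add_distrib]
  apply Finset.sum_congr rfl
  intro t ht
  rw [Finset.mem_range] at ht
  rw [wst_ZX _ _ _ _ _ (h1 t ht) (h2 t ht)]
  ring

lemma wind_XY (hk : 0 < k) (h1 : ∀ i < k, Adj (d i) (f (d i)))
    (h2 : ∀ i < k, Adj (d ((i+1) % k)) (f (d i)))
    (i j : ℕ) : wind f k d (i+1) j - wind f k d i (j+1) = flow f k d (i,j) (i,j) := by
  have := tele k hk (fun t => (if (d t).2 = j ∧ i ≤ (d t).1 then (1:ℤ) else 0))
  rw [wind, wind, flow, ← Finset.sum_sub_distrib, ← add_zero (Finset.sum _ (fun i_1 => flo _ _ _ _ _)),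
    ← this, ← Finset.sum_add_distrib]
  apply Finset.sum_congr rfl
  intro t ht
  rw [Finset.mem_range] at ht
  rw [wst_XY _ _ _ _ _ (h1 t ht) (h2 t ht)]

lemma wind_inner (hk : 0 < k) (h1 : ∀ i < k, Adj (d i) (f (d i)))
    (he : ∀ i < k, RhEdge n f (d i) (d ((i + 1) % k))) (p q : ℕ) (hw : wind f k d p q < 0) :
    1 ≤ p ∧ 1 ≤ q ∧ p + q + 1 ≤ n := by
  refine ⟨?_, ?_, ?_⟩
  · by_contra h
    obtain rfl : p = 0 := by omega
    have := tele k hk (fun t => (if q ≤ (d t).2 then (1:ℤ) else 0))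
    rw [wind, Finset.sum_congr rfl (fun t ht => wst_zero q _ _ _ (h1 t (Finset.mem_range.1 ht))
      (he t (Finset.mem_range.1 ht)).2.2.2), this] at hw
    exact lt_irrefl _ hw
  · by_contra h
    obtain rfl : q = 0 := by omega
    simp [wind, wst_row] at hw
  · by_contra h
    rw [wind, Finset.sum_congr rfl (fun t ht => wst_diag n p q (by omega) _ _ _
      (he t (Finset.mem_range.1 ht)).1 (he t (Finset.mem_range.1 ht)).2.1)] at hw
    simp at hw

/-- A clockwise cycle has negative winding number around some point. -/
lemma exists_neg (hk : 0 < k) (h1 : ∀ i < k, Adj (d i) (f (d i)))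
    (he : ∀ i < k, RhEdge n f (d i) (d ((i + 1) % k)))
    (ha : (∑ i ∈ Finset.range (2 * k),
        cross2 (cyclePt f d i) (cyclePt f d ((i + 1) % (2 * k)))) / 2 < 0) :
    ∃ p q, wind f k d p q < 0 := by
  rw [area_eq f k hk d h1 (fun i hi => (he i hi).2.2.2)] at ha
  by_contra! hcon
  have : (0:ℤ) ≤ ∑ i ∈ Finset.range k, hst (d i) (f (d i)) (d ((i+1) % k)) := by
    have h3 : ∑ p ∈ Finset.range n, ∑ q ∈ Finset.range n, wind f k d p q =
        ∑ i ∈ Finset.range k, hst (d i) (f (d i)) (d ((i+1) % k)) := by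
      rw [← Finset.sum_congr rfl (fun t ht => sum_wst n (d t) (f (d t)) (d ((t+1) % k))
        (he t (Finset.mem_range.1 ht)).1 (he t (Finset.mem_range.1 ht)).2.1)]
      rw [Finset.sum_comm]
      conv_rhs => rw [Finset.sum_comm]
      rw [Finset.sum_comm]
      apply Finset.sum_congr rfl
      intro p _
      rw [Finset.sum_comm]
      rfl
    rw [← h3]
    exact Finset.sum_nonneg fun p _ => Finset.sum_nonneg fun q _ => hcon p q
  have h4 : (0:ℝ) ≤ ((∑ i ∈ Finset.range k, hst (d i) (f (d i)) (d ((i+1) % k)) : ℤ) : ℝ) := by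
    exact_mod_cast this
  have := mul_nonneg (Real.sqrt_nonneg 3) h4
  linarith

end

/-- Abstract spiral lemma: the right-turning walk closes up in a triangle. -/
def Tri (E : ZMod 3 → ℤ × ℤ) (ty : ℤ × ℤ → ZMod 3) (Q : Set (ℤ × ℤ)) (c : ZMod 3) (B : ℤ × ℤ)
    (r : ℕ) : Prop :=
  1 ≤ r ∧ (∀ k < r, B + k • E c ∈ Q ∧ ty (B + k • E c) = c) ∧
  (∀ k < r, B + r • E c + k • E (c+1) ∈ Q ∧ ty (B + r • E c + k • E (c+1)) = c+1) ∧
  (∀ k < r, B + r • E c + r • E (c+1) + k • E (c+2) ∈ Q ∧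
    ty (B + r • E c + r • E (c+1) + k • E (c+2)) = c+2)

section
variable {E : ZMod 3 → ℤ × ℤ} {ty : ℤ × ℤ → ZMod 3} {Q : Set (ℤ × ℤ)}

lemma Tri.rot
    (hE : ∀ c, E c + E (c+1) + E (c+2) = 0)
    {c : ZMod 3} {B : ℤ × ℤ} {r : ℕ} (h : Tri E ty Q c B r) :
    Tri E ty Q (c+1) (B + r • E c) r := by
  obtain ⟨h0, h1, h2, h3⟩ := h
  have e1 : c + 1 + 1 = c + 2 := by ring
  have e2 : c + 1 + 2 = c := by
    have : (3 : ZMod 3) = 0 := rfl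
    linear_combination this
  have e3 : B + r • E c + r • E (c+1) + r • E (c+2) = B := by
    have := hE c
    rw [add_assoc, add_assoc, ← smul_add, ← smul_add, ← add_assoc, this]; simp
  refine ⟨h0, h2, ?_, ?_⟩
  · rw [e1]; exact h3
  · rw [e1, e2, e3]; exact h1

lemma run_exists
    (hstep : ∀ z ∈ Q, z + E (ty z) ∈ Q)
    (hturn : ∀ z ∈ Q, ty (z + E (ty z)) = ty z ∨ ty (z + E (ty z)) = ty z + 1)
    {N : ℕ} (hb : ∀ z ∈ Q, ∀ c, ∀ k : ℕ, z + k • E c ∈ Q → k ≤ N)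
    (V : ℤ × ℤ) (hV : V ∈ Q) :
    ∃ r : ℕ, 1 ≤ r ∧ r ≤ N ∧ (∀ k < r, V + k • E (ty V) ∈ Q ∧ ty (V + k • E (ty V)) = ty V) ∧
      V + r • E (ty V) ∈ Q ∧ ty (V + r • E (ty V)) = ty V + 1 := by
  classical
  have hex : ∃ k : ℕ, ¬ (V + k • E (ty V) ∈ Q ∧ ty (V + k • E (ty V)) = ty V) := by
    by_contra! hcon
    have := hb V hV (ty V) (N+1) (hcon _).1
    omega
  have hlt := fun k (hk : k < Nat.find hex) => not_not.1 (Nat.find_min hex hk)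
  have hsp := Nat.find_spec hex
  set r := Nat.find hex
  have hr : 1 ≤ r := by
    by_contra h
    have : r = 0 := by omega
    rw [this] at hsp
    simp [hV] at hsp
  obtain ⟨m, hm⟩ : ∃ m, r = m + 1 := ⟨r - 1, by omega⟩
  obtain ⟨q1, q2⟩ := hlt m (by omega)
  have e : V + r • E (ty V) = V + m • E (ty V) + E (ty (V + m • E (ty V))) := by
    rw [q2, hm, succ_nsmul, add_assoc]
  have s1 := hstep _ q1
  have s2 := hturn _ q1
  rw [← e, q2] at s2
  rw [← e] at s1
  refine ⟨r, hr, hb V hV _ _ s1, hlt, s1, ?_⟩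
  rcases s2 with s2 | s2
  · exact absurd ⟨s1, s2⟩ hsp
  · exact s2

/-- Inward spiral: `B` starts a run of length at least `r` in direction `c`, then a run of
length exactly `r` in direction `c+1`. -/
lemma inward
    (hE : ∀ c, E c + E (c+1) + E (c+2) = 0)
    (hstep : ∀ z ∈ Q, z + E (ty z) ∈ Q)
    (hturn : ∀ z ∈ Q, ty (z + E (ty z)) = ty z ∨ ty (z + E (ty z)) = ty z + 1)
    {N : ℕ} (hb : ∀ z ∈ Q, ∀ c, ∀ k : ℕ, z + k • E c ∈ Q → k ≤ N)
    (r : ℕ) : ∀ (c : ZMod 3) (V : ℤ × ℤ), 1 ≤ r →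
    (∀ k, 1 ≤ k → k ≤ r → V - k • E c ∈ Q ∧ ty (V - k • E c) = c) →
    (∀ k < r, V + k • E (c+1) ∈ Q ∧ ty (V + k • E (c+1)) = c+1) →
    V + r • E (c+1) ∈ Q → ty (V + r • E (c+1)) = c+2 → ∃ c B s, Tri E ty Q c B s := by
  induction r using Nat.strong_induction_on with
  | _ r ih =>
  intro c V hr h1 h2 h3 h4
  have e1 : c + 1 + 1 = c + 2 := by ring
  have e2 : c + 2 + 1 = c := by
    have : (3 : ZMod 3) = 0 := rfl
    linear_combination this
  have e2' : c + 1 + 2 = c := by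
    have : (3 : ZMod 3) = 0 := rfl
    linear_combination this
  obtain ⟨l, hl1, hlN, hl, hlQ, hlt⟩ := run_exists hstep hturn hb _ h3
  rw [h4] at hl hlQ hlt
  rw [e2] at hlt
  have e3 : V + r • E (c+1) + r • E (c+2) = V - r • E c := by
    have h0 := congrArg (fun z => r • z) (hE c)
    simp only [smul_add, smul_zero] at h0
    rw [eq_sub_iff_add_eq, ← sub_eq_zero, ← h0]; abel
  have hne : c ≠ c + 2 := by
    intro h
    have : (2 : ZMod 3) = 0 := by linear_combination -h
    exact absurd this (by decide)
  have hlr : l ≤ r := by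
    by_contra h
    have := (hl r (by omega)).2
    rw [e3, (h1 r hr le_rfl).2] at this
    exact hne this
  rcases hlr.eq_or_lt with rfl | hlt'
  · refine ⟨c, V - l • E c, l, hr, ?_, ?_, ?_⟩
    · intro k hk
      have e : V - l • E c + k • E c = V - (l - k) • E c := by
        obtain ⟨m, rfl⟩ : ∃ m, l = m + k := ⟨l - k, by omega⟩
        rw [Nat.add_sub_cancel, add_smul]; abel
      rw [e]
      exact h1 _ (by omega) (by omega)
    · intro k hk
      rw [sub_add_cancel]
      exact h2 k hk
    · intro k hk
      rw [sub_add_cancel]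
      exact hl k hk
  · refine ih l hlt' (c+1) (V + r • E (c+1)) hl1 ?_ ?_ ?_ ?_
    · intro k hk1 hk2
      have e : V + r • E (c+1) - k • E (c+1) = V + (r - k) • E (c+1) := by
        obtain ⟨m, rfl⟩ : ∃ m, r = m + k := ⟨r - k, by omega⟩
        rw [Nat.add_sub_cancel, add_smul]; abel
      rw [e]
      exact h2 _ (by omega)
    · rw [e1]; exact hl
    · rw [e1]; exact hlQ
    · rw [e1, e2']; exact hlt

lemma outward
    (hE : ∀ c, E c + E (c+1) + E (c+2) = 0)
    (hstep : ∀ z ∈ Q, z + E (ty z) ∈ Q)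
    (hturn : ∀ z ∈ Q, ty (z + E (ty z)) = ty z ∨ ty (z + E (ty z)) = ty z + 1)
    {N : ℕ} (hb : ∀ z ∈ Q, ∀ c, ∀ k : ℕ, z + k • E c ∈ Q → k ≤ N)
    (t : ℕ) : ∀ (s : ℕ) (c : ZMod 3) (V : ℤ × ℤ), N ≤ s + t →
    (∀ k, 1 ≤ k → k ≤ s → V - k • E c ∈ Q ∧ ty (V - k • E c) = c) →
    V ∈ Q → ty V = c + 1 → ∃ c B s, Tri E ty Q c B s := by
  induction t with
  | zero =>
    intro s c V hs h1 h2 h3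
    obtain ⟨r, hr1, hrN, hr, hrQ, hrt⟩ := run_exists hstep hturn hb _ h2
    rw [h3] at hr hrQ hrt
    exact inward hE hstep hturn hb r c V hr1 (fun k q1 q2 => h1 k q1 (by omega)) hr hrQ
      (by rw [hrt]; ring)
  | succ t ih =>
    intro s c V hs h1 h2 h3
    obtain ⟨r, hr1, hrN, hr, hrQ, hrt⟩ := run_exists hstep hturn hb _ h2
    rw [h3] at hr hrQ hrt
    by_cases hrs : r ≤ s
    · exact inward hE hstep hturn hb r c V hr1 (fun k q1 q2 => h1 k q1 (by omega)) hr hrQ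
        (by rw [hrt]; ring)
    · refine ih r (c+1) (V + r • E (c+1)) (by omega) ?_ hrQ hrt
      intro k hk1 hk2
      have e : V + r • E (c+1) - k • E (c+1) = V + (r - k) • E (c+1) := by
        obtain ⟨m, rfl⟩ : ∃ m, r = m + k := ⟨r - k, by omega⟩
        rw [Nat.add_sub_cancel, add_smul]; abel
      rw [e]
      exact hr _ (by omega)

lemma tri_exists
    (hE : ∀ c, E c + E (c+1) + E (c+2) = 0)
    (hstep : ∀ z ∈ Q, z + E (ty z) ∈ Q)
    (hturn : ∀ z ∈ Q, ty (z + E (ty z)) = ty z ∨ ty (z + E (ty z)) = ty z + 1)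
    {N : ℕ} (hb : ∀ z ∈ Q, ∀ c, ∀ k : ℕ, z + k • E c ∈ Q → k ≤ N)
    (V : ℤ × ℤ) (hV : V ∈ Q) : ∃ B s, Tri E ty Q 0 B s := by
  obtain ⟨c, B, s, h⟩ := outward hE hstep hturn hb N 0 (ty V - 1) V (by omega)
    (fun k h1 h2 => by omega) hV (by ring)
  have h' := h.rot hE
  have h'' := h'.rot hE
  fin_cases c
  · exact ⟨_, _, h⟩
  · exact ⟨_, _, h''⟩
  · exact ⟨_, _, h'⟩

end
end CW
namespace CW

/-- Directions of the right-turning walk. -/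
def EE : ZMod 3 → ℤ × ℤ := fun c => if c = 0 then (0, 1) else if c = 1 then (1, -1) else (-1, 0)

/-- Type of a downward triangle. -/
def tyf (f : ℕ × ℕ → ℕ × ℕ) (z : ℤ × ℤ) : ZMod 3 :=
  if f (z.1.toNat, z.2.toNat) = (z.1.toNat, z.2.toNat + 1) then 0
  else if f (z.1.toNat, z.2.toNat) = (z.1.toNat + 1, z.2.toNat) then 1 else 2

lemma EE0 : EE 0 = (0, 1) := rfl
lemma EE1 : EE 1 = (1, -1) := rfl
lemma EE2 : EE 2 = (-1, 0) := rfl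

lemma EE_sum (c : ZMod 3) : EE c + EE (c+1) + EE (c+2) = 0 := by
  revert c; decide

lemma tyf_nat (f : ℕ × ℕ → ℕ × ℕ) (i j : ℕ) : tyf f ((i:ℤ), (j:ℤ)) =
    if f (i, j) = (i, j+1) then 0 else if f (i,j) = (i+1,j) then 1 else 2 := by
  simp [tyf]

lemma ty_cases (f : ℕ × ℕ → ℕ × ℕ) (i j : ℕ) (h : Adj (i,j) (f (i,j))) :
    (tyf f ((i:ℤ), (j:ℤ)) = 0 ↔ f (i,j) = (i,j+1)) ∧
    (tyf f ((i:ℤ), (j:ℤ)) = 1 ↔ f (i,j) = (i+1,j)) ∧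
    (tyf f ((i:ℤ), (j:ℤ)) = 2 ↔ f (i,j) = (i,j)) := by
  have a1 : (0 : ZMod 3) ≠ 1 := by decide
  have a2 : (0 : ZMod 3) ≠ 2 := by decide
  have a3 : (1 : ZMod 3) ≠ 2 := by decide
  rw [tyf_nat]
  rcases h with h | h | h <;> rw [h] <;> simp [a1, a2, a3, a1.symm, a2.symm, a3.symm]

section
variable {n : ℕ} {S : Set (ℕ × ℕ)} {f : ℕ × ℕ → ℕ × ℕ} {k : ℕ} {d : ℕ → ℕ × ℕ}

/-- The downward triangle `(i,j)` touches a point of negative winding number. -/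
def Tch (f : ℕ × ℕ → ℕ × ℕ) (k : ℕ) (d : ℕ → ℕ × ℕ) (i j : ℕ) : Prop :=
  wind f k d i (j+1) < 0 ∨ wind f k d (i+1) (j+1) < 0 ∨ wind f k d (i+1) j < 0

lemma tch_types (hf : IsTiling n S f) (hk : 0 < k)
    (he : ∀ i < k, RhEdge n f (d i) (d ((i + 1) % k))) (i j : ℕ) (h : Tch f k d i j) :
    (i,j) ∈ DownTri n ∧ ((f (i,j) = (i,j+1) ∧ wind f k d (i+1) (j+1) < 0) ∨
      (f (i,j) = (i+1,j) ∧ 1 ≤ j ∧ wind f k d (i+1) j < 0) ∨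
      (f (i,j) = (i,j) ∧ 1 ≤ i ∧ wind f k d i (j+1) < 0)) := by
  have h1 : ∀ t < k, Adj (d t) (f (d t)) := fun t ht => hf.2 _ (he t ht).1
  have h2 : ∀ t < k, Adj (d ((t+1) % k)) (f (d t)) := fun t ht => (he t ht).2.2.2
  have hin := fun p q => wind_inner hk h1 he p q
  have hd : (i,j) ∈ DownTri n := by
    simp only [DownTri, Set.mem_ofPred_eq]
    rcases h with h | h | h <;> have := hin _ _ h <;> omega
  refine ⟨hd, ?_⟩
  have y1 := wind_YZ h1 h2 i j
  have y2 := wind_ZX hk h1 h2 i j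
  have y3 := wind_XY hk h1 h2 i j
  have n1 := flow_nonpos (f := f) (k := k) (d := d) (i,j) (i,j+1)
  have n2 := flow_nonpos (f := f) (k := k) (d := d) (i,j) (i+1,j)
  have n3 := flow_nonpos (f := f) (k := k) (d := d) (i,j) (i,j)
  unfold Tch at h
  rcases hf.2 _ hd with h | h | h
  · right; right
    have m1 := n1 (by rw [h]; simp)
    have m2 := n2 (by rw [h]; simp)
    have hw : wind f k d i (j+1) < 0 := by omega
    exact ⟨h, (hin _ _ hw).1, hw⟩
  · right; left
    have m1 := n1 (by rw [h]; simp)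
    have m2 := n3 (by rw [h]; simp)
    have hw : wind f k d (i+1) j < 0 := by omega
    exact ⟨h, (hin _ _ hw).2.1, hw⟩
  · left
    have m1 := n2 (by rw [h]; simp)
    have m2 := n3 (by rw [h]; simp)
    exact ⟨h, by omega⟩

lemma exists_tri (hf : IsTiling n S f) (hk : 0 < k)
    (he : ∀ i < k, RhEdge n f (d i) (d ((i + 1) % k)))
    (p q : ℕ) (hw : wind f k d p q < 0) :
    ∃ B s, Tri EE (tyf f) {z | 0 ≤ z.1 ∧ 0 ≤ z.2 ∧ (z.1.toNat, z.2.toNat) ∈ DownTri n} 0 B s := by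
  have h1 : ∀ t < k, Adj (d t) (f (d t)) := fun t ht => hf.2 _ (he t ht).1
  set Q : Set (ℤ × ℤ) := {z | 0 ≤ z.1 ∧ 0 ≤ z.2 ∧ Tch f k d z.1.toNat z.2.toNat} with hQ
  have hmem : ∀ i j : ℕ, (((i:ℤ), (j:ℤ)) : ℤ × ℤ) ∈ Q ↔ Tch f k d i j := by
    intro i j; simp [hQ]
  have hcast : ∀ z ∈ Q, ∃ i j : ℕ, z = ((i:ℤ), (j:ℤ)) := by
    rintro ⟨x, y⟩ ⟨hx, hy, _⟩
    exact ⟨x.toNat, y.toNat, by simp_all⟩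
  have both : ∀ z ∈ Q, z + EE (tyf f z) ∈ Q ∧
      (tyf f (z + EE (tyf f z)) = tyf f z ∨ tyf f (z + EE (tyf f z)) = tyf f z + 1) := by
    intro z hz
    obtain ⟨i, j, rfl⟩ := hcast z hz
    rw [hmem] at hz
    obtain ⟨hd, hc⟩ := tch_types hf hk he i j hz
    obtain ⟨t0, t1, t2⟩ := ty_cases f i j (hf.2 _ hd)
    rcases hc with ⟨hc, hw⟩ | ⟨hc, hj, hw⟩ | ⟨hc, hi, hw⟩
    · rw [t0.2 hc, EE0]
      have e : (((i:ℤ), (j:ℤ)) + (0, 1) : ℤ × ℤ) = ((i:ℤ), ((j+1 : ℕ):ℤ)) := by simp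
      have hT : Tch f k d i (j+1) := Or.inr (Or.inr hw)
      rw [e]
      refine ⟨(hmem _ _).2 hT, ?_⟩
      obtain ⟨hd', hc'⟩ := tch_types hf hk he _ _ hT
      obtain ⟨s0, s1, s2⟩ := ty_cases f i (j+1) (hf.2 _ hd')
      rcases hc' with h | h | h
      · left; exact s0.2 h.1
      · right; exact s1.2 h.1
      · have := hf.1.injOn hd hd' (hc.trans h.1.symm)
        simp at this
    · rw [t1.2 hc, EE1]
      have e : (((i:ℤ), (j:ℤ)) + (1, -1) : ℤ × ℤ) = (((i+1:ℕ):ℤ), ((j-1 : ℕ):ℤ)) := by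
        simp [hj]; ring
      have hT : Tch f k d (i+1) (j-1) := Or.inl (by rwa [Nat.sub_add_cancel hj])
      rw [e]
      refine ⟨(hmem _ _).2 hT, ?_⟩
      obtain ⟨hd', hc'⟩ := tch_types hf hk he _ _ hT
      obtain ⟨s0, s1, s2⟩ := ty_cases f (i+1) (j-1) (hf.2 _ hd')
      rcases hc' with h | h | h
      · have h' := h.1
        rw [Nat.sub_add_cancel hj] at h'
        have := hf.1.injOn hd hd' (hc.trans h'.symm)
        simp at this
      · left; exact s1.2 h.1
      · right; exact s2.2 h.1
    · rw [t2.2 hc, EE2]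
      have e : (((i:ℤ), (j:ℤ)) + (-1, 0) : ℤ × ℤ) = (((i-1:ℕ):ℤ), (j:ℤ)) := by
        simp [hi]; ring
      have hT : Tch f k d (i-1) j := Or.inr (Or.inl (by rwa [Nat.sub_add_cancel hi]))
      rw [e]
      refine ⟨(hmem _ _).2 hT, ?_⟩
      obtain ⟨hd', hc'⟩ := tch_types hf hk he _ _ hT
      obtain ⟨s0, s1, s2⟩ := ty_cases f (i-1) j (hf.2 _ hd')
      rcases hc' with h | h | h
      · right; rw [s0.2 h.1]; decide
      · have h' := h.1
        rw [Nat.sub_add_cancel hi] at h'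
        have := hf.1.injOn hd hd' (hc.trans h'.symm)
        simp at this
        omega
      · left; exact s2.2 h.1
  have hdown : ∀ z ∈ Q, 0 ≤ z.1 ∧ 0 ≤ z.2 ∧ (z.1.toNat, z.2.toNat) ∈ DownTri n :=
    fun z hz => ⟨hz.1, hz.2.1, (tch_types hf hk he _ _ hz.2.2).1⟩
  have hbd : ∀ z ∈ Q, ∀ c, ∀ t : ℕ, z + t • EE c ∈ Q → t ≤ n := by
    intro z hz c t ht
    have a := hdown _ hz
    have b := hdown _ ht
    simp only [DownTri, Set.mem_ofPred_eq] at a b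
    have : ∀ c : ZMod 3, c = 0 ∨ c = 1 ∨ c = 2 := by decide
    rcases this c with rfl | rfl | rfl
    · rw [EE0] at b; simp at b; omega
    · rw [EE1] at b; simp at b; omega
    · rw [EE2] at b; simp at b; omega
  obtain ⟨q1, q2, q3⟩ := wind_inner hk h1 he p q hw
  have hV : ((((p-1:ℕ):ℤ), ((q-1:ℕ):ℤ)) : ℤ × ℤ) ∈ Q := by
    rw [hmem]
    right; left
    rwa [Nat.sub_add_cancel q1, Nat.sub_add_cancel q2]
  obtain ⟨B, s, h0, h1, h2, h3⟩ := tri_exists EE_sum (fun z hz => (both z hz).1)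
    (fun z hz => (both z hz).2) hbd _ hV
  exact ⟨B, s, h0, fun k hk => ⟨hdown _ (h1 k hk).1, (h1 k hk).2⟩,
    fun k hk => ⟨hdown _ (h2 k hk).1, (h2 k hk).2⟩,
    fun k hk => ⟨hdown _ (h3 k hk).1, (h3 k hk).2⟩⟩

lemma tri_nat (hf : IsTiling n S f) {B : ℤ × ℤ} {r : ℕ}
    (h : Tri EE (tyf f) {z | 0 ≤ z.1 ∧ 0 ≤ z.2 ∧ (z.1.toNat, z.2.toNat) ∈ DownTri n} 0 B r) :
    ∃ a b : ℕ, 1 ≤ r ∧ a + b + r + 2 ≤ n ∧ (∀ t < r, f (a, b+t) = (a, b+t+1)) ∧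
      (∀ t < r, f (a+t, b+r-t) = (a+t+1, b+r-t)) ∧ (∀ t < r, f (a+r-t, b) = (a+r-t, b)) := by
  obtain ⟨h0, h1, h2, h3⟩ := h
  obtain ⟨x, y⟩ := B
  have b0 := h1 0 h0
  simp only [zero_smul, add_zero] at b0
  obtain ⟨a, rfl⟩ := Int.eq_ofNat_of_zero_le b0.1.1
  obtain ⟨b, rfl⟩ := Int.eq_ofNat_of_zero_le b0.1.2.1
  simp only [zero_add, EE0, EE1, EE2] at h1 h2 h3
  have key : ∀ (z : ℤ × ℤ) (i j : ℕ), z = ((i:ℤ), (j:ℤ)) →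
      (0 ≤ z.1 ∧ 0 ≤ z.2 ∧ (z.1.toNat, z.2.toNat) ∈ DownTri n) → i + j + 2 ≤ n ∧
      (tyf f z = 0 → f (i,j) = (i,j+1)) ∧ (tyf f z = 1 → f (i,j) = (i+1,j)) ∧
      (tyf f z = 2 → f (i,j) = (i,j)) := by
    rintro z i j rfl ⟨_, _, hz⟩
    simp only [Int.toNat_natCast] at hz
    obtain ⟨s0, s1, s2⟩ := ty_cases f i j (hf.2 _ hz)
    exact ⟨hz, s0.1, s1.1, s2.1⟩
  refine ⟨a, b, h0, ?_, ?_, ?_, ?_⟩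
  · have := (key _ a (b+r) (by simp) (h2 0 h0).1).1
    omega
  · intro t ht
    exact (key _ a (b+t) (by simp) (h1 t ht).1).2.1 (h1 t ht).2
  · intro t ht
    refine (key _ (a+t) (b+r-t) ?_ (h2 t ht).1).2.2.1 (h2 t ht).2
    simp; omega
  · intro t ht
    refine (key _ (a+r-t) b ?_ (h3 t ht).1).2.2.2 (h3 t ht).2
    simp; omega

lemma cwgd_of_tri {a b r : ℕ} (hr : 1 ≤ r) (hT : ∀ t < r, f (a, b+t) = (a, b+t+1))
    (hR : ∀ t < r, f (a+t, b+r-t) = (a+t+1, b+r-t)) (hL : ∀ t < r, f (a+r-t, b) = (a+r-t, b)) :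
    CWGD f a b (r+2) := by
  refine ⟨?_, hT 0 (by omega)⟩
  ext ⟨x, y⟩
  simp only [RingDown, RingUp, DownCells, UpCells, Set.mem_image, Set.mem_sdiff, Set.mem_ofPred_eq,
    Set.mem_union, Set.mem_insert_iff, Set.mem_singleton_iff, Prod.mk.injEq, Prod.exists]
  constructor
  · rintro ⟨i, j, h, hu⟩
    by_cases c1 : i = a ∧ j < b + r
    · have := hT (j - b) (by omega)
      rw [show b + (j - b) = j by omega, ← c1.1, hu, Prod.mk.injEq] at this
      omega
    · by_cases c2 : j = b
      · have := hL (a + r - i) (by omega)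
        rw [show a + r - (a + r - i) = i by omega, ← c2, hu, Prod.mk.injEq] at this
        omega
      · have := hR (i - a) (by omega)
        rw [show a + (i - a) = i by omega, show b + r - (i - a) = j by omega, hu,
          Prod.mk.injEq] at this
        omega
  · intro h
    by_cases c1 : x = a
    · refine ⟨a, y - 1, by omega, ?_⟩
      have := hT (y - 1 - b) (by omega)
      rw [show b + (y - 1 - b) = y - 1 by omega] at this
      rw [this, Prod.mk.injEq]; omega
    · by_cases c2 : y = b
      · refine ⟨x, b, by omega, ?_⟩
        have := hL (a + r - x) (by omega)
        rw [show a + r - (a + r - x) = x by omega] at this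
        rw [this, c2]
      · refine ⟨x - 1, y, by omega, ?_⟩
        have := hR (x - 1 - a) (by omega)
        rw [show a + (x - 1 - a) = x - 1 by omega, show b + r - (x - 1 - a) = y by omega] at this
        rw [this, Prod.mk.injEq]; omega

lemma tri_of_cwgd (hf : IsTiling n S f) {a b r : ℕ} (hr : 1 ≤ r) (hn : a + b + r + 2 ≤ n)
    (h : CWGD f a b (r+2)) :
    (∀ t < r, f (a, b+t) = (a, b+t+1)) ∧
    (∀ t < r, f (a+t, b+r-t) = (a+t+1, b+r-t)) ∧ (∀ t < r, f (a+r-t, b) = (a+r-t, b)) := by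
  obtain ⟨him, h0⟩ := h
  have hmem : ∀ x y, (x, y) ∈ RingDown a b (r+2) → f (x,y) ∈ RingUp a b (r+2) := by
    intro x y hxy; rw [← him]; exact ⟨_, hxy, rfl⟩
  have hadj : ∀ x y, x + y + 2 ≤ n → f (x,y) = (x,y) ∨ f (x,y) = (x+1,y) ∨ f (x,y) = (x,y+1) :=
    fun x y hxy => hf.2 (x,y) hxy
  have hinj : ∀ x y x' y', x + y + 2 ≤ n → x' + y' + 2 ≤ n → f (x,y) = f (x',y') →
      x = x' ∧ y = y' := by
    intro x y x' y' h1 h2 h3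
    have := hf.1.injOn (show (x,y) ∈ DownTri n from h1) (show (x',y') ∈ DownTri n from h2) h3
    simpa using this
  simp only [RingDown, RingUp, DownCells, UpCells, Set.mem_sdiff, Set.mem_ofPred_eq,
    Set.mem_union, Set.mem_insert_iff, Set.mem_singleton_iff] at hmem
  have hT : ∀ t < r, f (a, b+t) = (a, b+t+1) := by
    intro t
    induction t with
    | zero => intro _; exact h0
    | succ t ih =>
      intro ht
      have i1 := ih (by omega)
      have m1 := hmem a (b+(t+1)) (by omega)
      rcases hadj a (b+(t+1)) (by omega) with h | h | h
      · have := hinj a (b+t) a (b+(t+1)) (by omega) (by omega) (by rw [h, i1, add_assoc])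
        omega
      · rw [h] at m1; simp only [Prod.mk.injEq] at m1; omega
      · exact h
  have hR : ∀ t < r, f (a+t, b+r-t) = (a+t+1, b+r-t) := by
    intro t
    induction t with
    | zero =>
      intro _
      have m1 := hmem a (b+r) (by omega)
      have i1 := hT (r-1) (by omega)
      rcases hadj a (b+r) (by omega) with h | h | h
      · have := hinj a (b+(r-1)) a (b+r) (by omega) (by omega)
          (by rw [h, i1, Prod.mk.injEq]; omega)
        omega
      · exact h
      · rw [h] at m1; simp only [Prod.mk.injEq, true_and, and_true, or_true, true_or, not_true_eq_false] at m1; omega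
    | succ t ih =>
      intro ht
      have i1 := ih (by omega)
      have m1 := hmem (a+(t+1)) (b+r-(t+1)) (by omega)
      rcases hadj (a+(t+1)) (b+r-(t+1)) (by omega) with h | h | h
      · rw [h] at m1; simp only [Prod.mk.injEq] at m1; omega
      · exact h
      · have := hinj (a+t) (b+r-t) (a+(t+1)) (b+r-(t+1)) (by omega) (by omega)
          (by rw [h, i1, Prod.mk.injEq]; omega)
        omega
  refine ⟨hT, hR, ?_⟩
  intro t
  induction t with
  | zero =>
    intro _
    have m1 := hmem (a+r) b (by omega)
    have i1 := hR (r-1) (by omega)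
    rcases hadj (a+r) b (by omega) with h | h | h
    · exact h
    · rw [h] at m1; simp only [Prod.mk.injEq, true_and, and_true, or_true, true_or, not_true_eq_false] at m1; omega
    · have := hinj (a+(r-1)) (b+r-(r-1)) (a+r) b (by omega) (by omega)
        (by rw [h, i1, Prod.mk.injEq]; omega)
      omega
  | succ t ih =>
    intro ht
    have i1 := ih (by omega)
    have m1 := hmem (a+r-(t+1)) b (by omega)
    rcases hadj (a+r-(t+1)) b (by omega) with h | h | h
    · exact h
    · have := hinj (a+r-t) b (a+r-(t+1)) b (by omega) (by omega)
        (by rw [h, i1, Prod.mk.injEq]; omega)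
      omega
    · rw [h] at m1; simp only [Prod.mk.injEq] at m1; omega

/-- The explicit cycle around a GD ring. -/
def ringCyc (a b r i : ℕ) : ℕ × ℕ :=
  if i < r then (a, b + i) else if i < 2 * r then (a + (i - r), b + r - (i - r))
  else (a + r - (i - 2 * r), b)

lemma cycle_of_tri {a b r : ℕ} (hr : 1 ≤ r) (hn : a + b + r + 2 ≤ n)
    (hT : ∀ t < r, f (a, b+t) = (a, b+t+1))
    (hR : ∀ t < r, f (a+t, b+r-t) = (a+t+1, b+r-t)) (hL : ∀ t < r, f (a+r-t, b) = (a+r-t, b)) :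
    HasClockwiseCycle n f := by
  have c1 : ∀ t < r, ringCyc a b r t = (a, b+t) := by
    intro t ht; rw [ringCyc, if_pos ht]
  have c2 : ∀ t < r, ringCyc a b r (r+t) = (a+t, b+r-t) := by
    intro t ht
    rw [ringCyc, if_neg (by omega), if_pos (by omega), Nat.add_sub_cancel_left]
  have c3 : ∀ t < r, ringCyc a b r (2*r+t) = (a+r-t, b) := by
    intro t ht
    rw [ringCyc, if_neg (by omega), if_neg (by omega), Nat.add_sub_cancel_left]
  have n1 : ∀ t < r, ringCyc a b r ((t+1) % (3*r)) = (a, b+t+1) := by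
    intro t ht
    rw [Nat.mod_eq_of_lt (by omega)]
    by_cases h : t + 1 < r
    · rw [c1 _ h, add_assoc]
    · rw [show t + 1 = r + 0 by omega, c2 0 (by omega), Prod.mk.injEq]; omega
  have n2 : ∀ t < r, ringCyc a b r ((r+t+1) % (3*r)) = (a+t+1, b+r-t-1) := by
    intro t ht
    rw [Nat.mod_eq_of_lt (by omega)]
    by_cases h : t + 1 < r
    · rw [add_assoc, c2 _ h, Prod.mk.injEq]; omega
    · rw [show r + t + 1 = 2*r + 0 by omega, c3 0 (by omega), Prod.mk.injEq]; omega
  have n3 : ∀ t < r, ringCyc a b r ((2*r+t+1) % (3*r)) = (a+r-t-1, b) := by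
    intro t ht
    by_cases h : t + 1 < r
    · rw [Nat.mod_eq_of_lt (by omega), add_assoc, c3 _ h, Prod.mk.injEq]; omega
    · rw [show 2 * r + t + 1 = 3 * r by omega, Nat.mod_self, c1 0 (by omega), Prod.mk.injEq]
      omega
  have hedge : ∀ i < 3 * r, RhEdge n f (ringCyc a b r i) (ringCyc a b r ((i+1) % (3*r))) ∧
      Adj (ringCyc a b r i) (f (ringCyc a b r i)) := by
    intro i hi
    by_cases h1 : i < r
    · rw [n1 i h1, c1 i h1]
      simp only [RhEdge, DownTri, Adj, Set.mem_ofPred_eq, ne_eq]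
      rw [hT i h1]; simp only [Prod.mk.injEq, true_and, and_true, or_true, true_or, not_true_eq_false]; omega
    · by_cases h2 : i < 2 * r
      · obtain ⟨t, rfl⟩ : ∃ t, i = r + t := ⟨i - r, by omega⟩
        have ht : t < r := by omega
        rw [n2 t ht, c2 t ht]
        simp only [RhEdge, DownTri, Adj, Set.mem_ofPred_eq, ne_eq]
        rw [hR t ht]; simp only [Prod.mk.injEq, true_and, and_true, or_true, true_or, not_true_eq_false]; omega
      · obtain ⟨t, rfl⟩ : ∃ t, i = 2 * r + t := ⟨i - 2 * r, by omega⟩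
        have ht : t < r := by omega
        rw [n3 t ht, c3 t ht]
        simp only [RhEdge, DownTri, Adj, Set.mem_ofPred_eq, ne_eq]
        rw [hL t ht]; simp only [Prod.mk.injEq, true_and, and_true, or_true, true_or, not_true_eq_false]; omega
  refine ⟨3 * r, ringCyc a b r, by omega, ?_, fun i hi => (hedge i hi).1, ?_⟩
  · intro i hi j hj hij
    unfold ringCyc at hij
    split_ifs at hij <;> rw [Prod.mk.injEq] at hij <;> omega
  · rw [area_eq f (3*r) (by omega) _ (fun i hi => (hedge i hi).2)
      (fun i hi => (hedge i hi).1.2.2.2)]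
    have hs : ∑ i ∈ Finset.range (3*r), hst (ringCyc a b r i) (f (ringCyc a b r i))
        (ringCyc a b r ((i+1) % (3*r))) < 0 := by
      rw [show 3 * r = 2 * r + r by ring, Finset.sum_range_add, show 2 * r = r + r by ring,
        Finset.sum_range_add, ← two_mul, show 2 * r + r = 3 * r by ring,
        ← Finset.sum_add_distrib, ← Finset.sum_add_distrib]
      apply Finset.sum_neg
      · intro t ht
        rw [Finset.mem_range] at ht
        rw [n1 t ht, n2 t ht, n3 t ht, c1 t ht, c2 t ht, c3 t ht, hT t ht, hR t ht, hL t ht]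
        simp only [hst, Prod.mk.injEq, true_and, and_true]
        split_ifs <;> omega
      · exact ⟨0, Finset.mem_range.2 hr⟩
    have h3 : (0:ℝ) < Real.sqrt 3 := Real.sqrt_pos.2 (by norm_num)
    have h4 : ((∑ i ∈ Finset.range (3*r), hst (ringCyc a b r i) (f (ringCyc a b r i))
        (ringCyc a b r ((i+1) % (3*r))) : ℤ) : ℝ) < 0 := by exact_mod_cast hs
    have := mul_neg_of_pos_of_neg h3 h4
    linarith

end
end CW

/-- A tiling `f` of Δ contains a CW-GD at some `(a,b,m)` if and only if
the rhombus graph of `f` contains a clockwise directed cycle. -/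
theorem cwgd_iff_clockwise_cycle (n : ℕ) (hn : 0 < n) (S : Finset (ℕ × ℕ))
    (hS : ↑S ⊆ UpTri n) (hcard : S.card = n)
    (f : ℕ × ℕ → ℕ × ℕ) (hf : IsTiling n ↑S f) :
    (∃ a b m : ℕ, 3 ≤ m ∧ a + b + m ≤ n ∧ CWGD f a b m) ↔ HasClockwiseCycle n f := by
  constructor
  · rintro ⟨a, b, m, hm, hmn, h⟩
    obtain ⟨r, rfl⟩ : ∃ r, m = r + 2 := ⟨m - 2, by omega⟩
    obtain ⟨h1, h2, h3⟩ := CW.tri_of_cwgd hf (by omega) (by omega) h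
    exact CW.cycle_of_tri (by omega) (by omega) h1 h2 h3
  · rintro ⟨k, d, hk, _, he, ha⟩
    obtain ⟨p, q, hw⟩ := CW.exists_neg hk (fun t ht => hf.2 _ (he t ht).1) he ha
    obtain ⟨B, r, ht⟩ := CW.exists_tri hf hk he p q hw
    obtain ⟨a, b, h0, h1, h2, h3, h4⟩ := CW.tri_nat hf ht
    exact ⟨a, b, r + 2, by omega, by omega, CW.cwgd_of_tri h0 h2 h3 h4⟩
end
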